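/- arXiv:2102.01320 — 2 statements merged into one kernel-verified Lean document; each statement's English description precedes it below -/
import Mathlib

section
/- A binary function is linear if and only if it has no minor isomorphic to any of the following: (i) f_α for any α ∈ ℝ∖{0,1}; (ii) the order-two binary function g on ground set {a,b} with g(X)=1 for |X| ∈ {0,1} and g(X)=−1 for |X|=2; (iii) the order-four binary function f_{U24} on ground set {a,b,c,d} with f_{U24}(X)=0 for |X| ∈ {1,2}, f_{U24}(X)=1 for |X| ∈ {0,3}, and f_{U24}(X)=−1 for |X|=4. -/
/-- A binary function on finite ground set `E`: a function `f : 2^E → ℝ` with `f ∅ = 1`.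
(The function is defined on all finite sets; only its values on subsets of `E` matter.) -/
structure BinaryFunction (α : Type) [DecidableEq α] where
  E : Finset α
  f : Finset α → ℝ
  empty_one : f ∅ = 1

namespace BinaryFunction

variable {α : Type} [DecidableEq α]

/-- Contraction of a single element: `(f/e)(Y) = f(Y)` on ground set `E ∖ {e}`. -/
def contract (g : BinaryFunction α) (e : α) : BinaryFunction α :=
  ⟨g.E.erase e, g.f, g.empty_one⟩

/-- Deletion of a single element: `(f∖e)(Y) = (f(Y) + f(Y ∪ {e})) / (1 + f({e}))`
on ground set `E ∖ {e}`; well defined iff `1 + f({e}) ≠ 0` (in which case the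
`if` branch below agrees with the formula, since the formula gives `1` at `∅`). -/
noncomputable def delete (g : BinaryFunction α) (e : α) : BinaryFunction α :=
  ⟨g.E.erase e,
   fun Y => if Y = ∅ then 1 else (g.f Y + g.f (Y ∪ {e})) / (1 + g.f {e}),
   by simp⟩

/-- Contraction of a set: `(f/X)(Y) = f(Y)` on ground set `E ∖ X`. -/
def contractSet (g : BinaryFunction α) (X : Finset α) : BinaryFunction α :=
  ⟨g.E \ X, g.f, g.empty_one⟩

/-- Deletion of a set: `(f∖X)(Y) = (∑_{Z ⊆ X} f(Y ∪ Z)) / (∑_{Z ⊆ X} f(Z))`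
on ground set `E ∖ X`; well defined iff `∑_{Z ⊆ X} f(Z) ≠ 0` (in which case the
`if` branch agrees with the formula, since the formula gives `1` at `∅`). -/
noncomputable def deleteSet (g : BinaryFunction α) (X : Finset α) : BinaryFunction α :=
  ⟨g.E \ X,
   fun Y => if Y = ∅ then 1 else
     (∑ Z ∈ X.powerset, g.f (Y ∪ Z)) / (∑ Z ∈ X.powerset, g.f Z),
   by simp⟩

/-- `IsMinorOf m f`: `m` is obtained from `f` by a sequence of single-element
contractions and deletions, each step being well defined. -/
inductive IsMinorOf : BinaryFunction α → BinaryFunction α → Prop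
  | refl (f : BinaryFunction α) : IsMinorOf f f
  | contract {f g : BinaryFunction α} (e : α) (he : e ∈ g.E)
      (h : IsMinorOf g f) : IsMinorOf (g.contract e) f
  | delete {f g : BinaryFunction α} (e : α) (he : e ∈ g.E)
      (hw : 1 + g.f {e} ≠ 0) (h : IsMinorOf g f) : IsMinorOf (g.delete e) f

/-- `f` is stable: every sequence of single-element contractions and deletions applied
to `f` is well defined at every step, i.e. at every reachable minor `g`, deletion of any
ground-set element is well defined. -/
def Stable (f : BinaryFunction α) : Prop :=
  ∀ g : BinaryFunction α, IsMinorOf g f → ∀ e ∈ g.E, 1 + g.f {e} ≠ 0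

/-- Isomorphism of binary functions: a bijection `φ` of ground sets with
`f(X) = f'(φ(X))` for all `X ⊆ E`. -/
def Isomorphic (g g' : BinaryFunction α) : Prop :=
  ∃ φ : α → α, Set.InjOn φ ↑g.E ∧ g.E.image φ = g'.E ∧
    ∀ X ⊆ g.E, g.f X = g'.f (X.image φ)

/-- `f_α`: the order-one binary function on ground set `{e}` with value `α` on `{e}`. -/
def fAlpha (e : α) (a : ℝ) : BinaryFunction α :=
  ⟨{e}, fun X => if X = ∅ then 1 else a, by simp⟩

/-- The rank function `Qf(X) = log₂((∑_{Y ⊆ E} f(Y)) / (∑_{Y ⊆ E∖X} f(Y)))`. -/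
noncomputable def Q (g : BinaryFunction α) (X : Finset α) : ℝ :=
  Real.logb 2 ((∑ Y ∈ g.E.powerset, g.f Y) / (∑ Y ∈ (g.E \ X).powerset, g.f Y))

/-- `f` is rankable: for every `X ⊆ E` the denominator in `Qf(X)` is nonzero and
the quotient is strictly positive. -/
def Rankable (g : BinaryFunction α) : Prop :=
  ∀ X ⊆ g.E, (∑ Y ∈ (g.E \ X).powerset, g.f Y) ≠ 0 ∧
    0 < (∑ Y ∈ g.E.powerset, g.f Y) / (∑ Y ∈ (g.E \ X).powerset, g.f Y)

/-- `f` is `k`-polymatroidal: rankable, with `Qf` satisfying R0–R3. -/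
def Polymatroidal (k : ℕ) (g : BinaryFunction α) : Prop :=
  Rankable g ∧
  (∀ X ⊆ g.E, ∃ n : ℕ, g.Q X = n) ∧
  (∀ X ⊆ g.E, g.Q X ≤ (k : ℝ) * X.card) ∧
  (∀ X ⊆ g.E, ∀ e ∈ g.E, e ∉ X → g.Q X ≤ g.Q (insert e X)) ∧
  (∀ X ⊆ g.E, ∀ a ∈ g.E, ∀ b ∈ g.E, a ∉ X → b ∉ X → a ≠ b →
    g.Q X + g.Q (insert a (insert b X)) ≤ g.Q (insert a X) + g.Q (insert b X))

/-- `f` is linear: `{0,1}`-valued on subsets of `E`, and closed under symmetric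
difference of supports. -/
def Linear (g : BinaryFunction α) : Prop :=
  (∀ X ⊆ g.E, g.f X = 0 ∨ g.f X = 1) ∧
  (∀ X ⊆ g.E, ∀ Y ⊆ g.E, g.f X = 1 → g.f Y = 1 → g.f (symmDiff X Y) = 1)

/-- The order-two excluded minor `g`: value `1` on sets of size `0,1`, `-1` on size `2`. -/
def gTwo (a b : α) : BinaryFunction α :=
  ⟨{a, b}, fun X => if X.card = 2 then -1 else 1, by simp⟩

/-- The order-four excluded minor `f_{U_{2,4}}`: `1` on sizes `0,3`, `0` on sizes `1,2`,
`-1` on size `4`. -/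
def fU24 (a b c d : α) : BinaryFunction α :=
  ⟨{a, b, c, d},
   fun X => if X.card = 0 then 1 else if X.card ≤ 2 then 0
            else if X.card = 3 then 1 else -1,
   by simp⟩

/-- The order-two excluded minors `f_{α,β,γ}` of the `k`-polymatroidal binary functions. -/
def fABG (a b : α) (p q r : ℕ) : BinaryFunction α :=
  ⟨{a, b},
   fun X =>
     if X = ∅ then 1
     else if X = {a} then 2 ^ (p + r - q + 1) - 1
     else if X = {b} then 2 ^ (r + 1) - 1
     else 2 ^ (p + r + 1) - 2 ^ (r + 1) - 2 ^ (p + r - q + 1) + 1,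
   by simp⟩

end BinaryFunction

namespace BinaryFunction

variable {α : Type} [DecidableEq α]

theorem delete_f_eq (g : BinaryFunction α) {e : α} (h : 1 + g.f {e} ≠ 0) (Y : Finset α) :
    (g.delete e).f Y = (g.f Y + g.f (insert e Y)) / (1 + g.f {e}) := by
  by_cases hY : Y = ∅
  · subst hY
    simp [delete, g.empty_one, div_self h]
  · simp [delete, hY]

theorem Linear.contract {g : BinaryFunction α} (hg : g.Linear) (e : α) :
    (g.contract e).Linear :=
  ⟨fun X hX => hg.1 X (hX.trans (Finset.erase_subset _ _)),
    fun X hX Y hY => hg.2 X (hX.trans (Finset.erase_subset _ _)) Y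
      (hY.trans (Finset.erase_subset _ _))⟩

theorem symmDiff_insert_self {e : α} {Y : Finset α} (h : e ∉ Y) :
    symmDiff (insert e Y) Y = {e} := by
  ext x; simp only [Finset.mem_symmDiff, Finset.mem_insert, Finset.mem_singleton]; grind

theorem symmDiff_singleton_of_notMem {e : α} {Y : Finset α} (h : e ∉ Y) :
    symmDiff {e} Y = insert e Y := by
  ext x; simp only [Finset.mem_symmDiff, Finset.mem_insert, Finset.mem_singleton]; grind

theorem Linear.delete {g : BinaryFunction α} (hg : g.Linear) {e : α} (he : e ∈ g.E) :
    (g.delete e).Linear := by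
  have hes : ({e} : Finset α) ⊆ g.E := by simpa using he
  have hsub : ∀ X, X ⊆ (g.delete e).E → X ⊆ g.E ∧ e ∉ X ∧ insert e X ⊆ g.E := by
    intro X hX
    have hX' : X ⊆ g.E.erase e := hX
    refine ⟨hX'.trans (Finset.erase_subset _ _), fun h => ?_, ?_⟩
    · simpa using hX' h
    · exact Finset.insert_subset he (hX'.trans (Finset.erase_subset _ _))
  rcases hg.1 {e} hes with h0 | h1
  · have hval : ∀ X, (g.delete e).f X = g.f X + g.f (insert e X) := by
      intro X
      rw [delete_f_eq _ (by rw [h0]; norm_num), h0]; simp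
    have hbin : ∀ X, X ⊆ (g.delete e).E → (g.delete e).f X = 0 ∨ (g.delete e).f X = 1 := by
      intro X hX
      obtain ⟨hXE, heX, hiX⟩ := hsub X hX
      rw [hval]
      rcases hg.1 X hXE with h | h <;> rcases hg.1 _ hiX with h' | h' <;> simp [h, h']
      have := hg.2 _ hiX _ hXE h' h
      rw [symmDiff_insert_self heX, h0] at this
      norm_num at this
    refine ⟨hbin, fun X hX Y hY h1 h2 => ?_⟩
    have hZ : symmDiff X Y ⊆ (g.delete e).E := symmDiff_le_sup.trans (Finset.union_subset hX hY)
    obtain ⟨hXE, heX, hiX⟩ := hsub X hX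
    obtain ⟨hYE, heY, hiY⟩ := hsub Y hY
    obtain ⟨hZE, heZ, hiZ⟩ := hsub _ hZ
    have hz : g.f (symmDiff X Y) = 1 ∨ g.f (insert e (symmDiff X Y)) = 1 := by
      have e1 : symmDiff (insert e X) (insert e Y) = symmDiff X Y := by
        ext x; simp only [Finset.mem_symmDiff, Finset.mem_insert]; grind
      have e2 : symmDiff (insert e X) Y = insert e (symmDiff X Y) := by
        ext x; simp only [Finset.mem_symmDiff, Finset.mem_insert]; grind
      have e3 : symmDiff X (insert e Y) = insert e (symmDiff X Y) := by
        ext x; simp only [Finset.mem_symmDiff, Finset.mem_insert]; grind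
      rw [hval] at h1 h2
      have hX1 : g.f X = 1 ∨ g.f (insert e X) = 1 := by
        rcases hg.1 X hXE with h | h
        · right; linarith
        · exact Or.inl h
      have hY1 : g.f Y = 1 ∨ g.f (insert e Y) = 1 := by
        rcases hg.1 Y hYE with h | h
        · right; linarith
        · exact Or.inl h
      rcases hX1 with h | h <;> rcases hY1 with h' | h'
      · exact Or.inl (hg.2 _ hXE _ hYE h h')
      · exact Or.inr (e3 ▸ hg.2 _ hXE _ hiY h h')
      · exact Or.inr (e2 ▸ hg.2 _ hiX _ hYE h h')
      · exact Or.inl (e1 ▸ hg.2 _ hiX _ hiY h h')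
    refine (hbin _ hZ).resolve_left fun h => ?_
    rw [hval] at h
    rcases hg.1 _ hZE with h' | h' <;> rcases hg.1 _ hiZ with h'' | h'' <;>
      rw [h', h''] at h <;> norm_num at h
    rcases hz with hz | hz <;> linarith
  · have hval : ∀ X, X ⊆ (g.delete e).E → (g.delete e).f X = g.f X := by
      intro X hX
      obtain ⟨hXE, heX, hiX⟩ := hsub X hX
      have : g.f (insert e X) = g.f X := by
        rcases hg.1 X hXE with h | h
        · rcases hg.1 _ hiX with h' | h'
          · rw [h, h']
          · have := hg.2 _ hes _ hiX h1 h'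
            rw [← symmDiff_singleton_of_notMem heX, symmDiff_symmDiff_cancel_left, h] at this
            norm_num at this
        · have := hg.2 _ hes _ hXE h1 h
          rw [← symmDiff_singleton_of_notMem heX, this, h]
      rw [delete_f_eq _ (by rw [h1]; norm_num), h1, this]; ring
    refine ⟨fun X hX => ?_, fun X hX Y hY hx hy => ?_⟩
    · rw [hval X hX]; exact hg.1 X (hsub X hX).1
    · rw [hval _ (symmDiff_le_sup.trans (Finset.union_subset hX hY))]
      rw [hval X hX] at hx
      rw [hval Y hY] at hy
      exact hg.2 X (hsub X hX).1 Y (hsub Y hY).1 hx hy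

theorem Linear.of_isMinorOf {m f : BinaryFunction α} (hf : f.Linear) (h : IsMinorOf m f) :
    m.Linear := by
  induction h with
  | refl => exact hf
  | contract e he _ ih => exact (ih hf).contract e
  | delete e he _ _ ih => exact (ih hf).delete he

theorem IsMinorOf.trans {m g f : BinaryFunction α} (h : IsMinorOf m g) (hgf : IsMinorOf g f) :
    IsMinorOf m f := by
  induction h with
  | refl => exact hgf
  | contract e he _ ih => exact .contract e he (ih hgf)
  | delete e he hw _ ih => exact .delete e he hw (ih hgf)

/-- Being isomorphic to one of the excluded minors for linearity. -/
def IsExcluded (m : BinaryFunction α) : Prop :=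
  (∃ (e : α) (a : ℝ), a ≠ 0 ∧ a ≠ 1 ∧ m.Isomorphic (fAlpha e a)) ∨
    (∃ a b : α, a ≠ b ∧ m.Isomorphic (gTwo a b)) ∨
    (∃ a b c d : α, ({a, b, c, d} : Finset α).card = 4 ∧ m.Isomorphic (fU24 a b c d))

theorem Isomorphic.f_E {g g' : BinaryFunction α} (h : g.Isomorphic g') :
    g.f g.E = g'.f g'.E := by
  obtain ⟨φ, -, hE, hf⟩ := h
  rw [hf _ subset_rfl, hE]

theorem IsExcluded.not_linear {m : BinaryFunction α} (h : m.IsExcluded) : ¬ m.Linear := by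
  intro hl
  have hm := hl.1 m.E subset_rfl
  rcases h with ⟨e, a, h0, h1, h⟩ | ⟨a, b, hab, h⟩ | ⟨a, b, c, d, hc, h⟩ <;> rw [h.f_E] at hm
  · simp [fAlpha, h0, h1] at hm
  · simp [gTwo, Finset.card_pair hab] at hm
    norm_num at hm
  · simp only [fU24, hc] at hm
    norm_num at hm

theorem Isomorphic.of_eqOn {g g' : BinaryFunction α} (hE : g.E = g'.E)
    (h : ∀ X ⊆ g.E, g.f X = g'.f X) : g.Isomorphic g' :=
  ⟨id, Set.injOn_id _, by simpa using hE, by simpa using h⟩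

/-- All well-defined single-element contractions and deletions are linear. -/
structure ProperMinorsLinear (f : BinaryFunction α) : Prop where
  contract : ∀ e ∈ f.E, (f.contract e).Linear
  delete : ∀ e ∈ f.E, 1 + f.f {e} ≠ 0 → (f.delete e).Linear

namespace ProperMinorsLinear

variable {f : BinaryFunction α}

theorem eq_zero_or_one (hf : f.ProperMinorsLinear) {X : Finset α} (hX : X ⊂ f.E) :
    f.f X = 0 ∨ f.f X = 1 := by
  obtain ⟨e, he, heX⟩ := Finset.exists_of_ssubset hX
  exact (hf.contract e he).1 X (Finset.subset_erase.2 ⟨hX.1, heX⟩)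

theorem symmDiff_eq_one (hf : f.ProperMinorsLinear) {X Y : Finset α} {e : α} (he : e ∈ f.E)
    (hX : X ⊆ f.E.erase e) (hY : Y ⊆ f.E.erase e) (h1 : f.f X = 1) (h2 : f.f Y = 1) :
    f.f (symmDiff X Y) = 1 :=
  (hf.contract e he).2 X hX Y hY h1 h2

theorem singleton_eq (hf : f.ProperMinorsLinear) (hn : 2 ≤ f.E.card) {e : α} (he : e ∈ f.E) :
    f.f {e} = 0 ∨ f.f {e} = 1 := by
  refine hf.eq_zero_or_one (Finset.ssubset_iff_subset_ne.2 ⟨by simpa using he, fun h => ?_⟩)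
  rw [← h] at hn
  simp at hn

theorem one_add_ne_zero (hf : f.ProperMinorsLinear) (hn : 2 ≤ f.E.card) {e : α} (he : e ∈ f.E) :
    1 + f.f {e} ≠ 0 := by
  rcases hf.singleton_eq hn he with h | h <;> rw [h] <;> norm_num

theorem delete_linear (hf : f.ProperMinorsLinear) (hn : 2 ≤ f.E.card) {e : α} (he : e ∈ f.E) :
    (f.delete e).Linear :=
  hf.delete e he (hf.one_add_ne_zero hn he)

theorem add_insert_eq (hf : f.ProperMinorsLinear) (hn : 2 ≤ f.E.card) {e : α} (he : e ∈ f.E)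
    {W : Finset α} (hW : W ⊆ f.E.erase e) :
    f.f W + f.f (insert e W) = 0 ∨ f.f W + f.f (insert e W) = 1 + f.f {e} := by
  have h0 := hf.one_add_ne_zero hn he
  have := (hf.delete_linear hn he).1 W hW
  rw [delete_f_eq _ h0, div_eq_zero_iff, div_eq_one_iff_eq h0] at this
  tauto

/-- The symmetric-difference axiom in the deletion of `e`. -/
theorem add_insert_symmDiff_ne_zero (hf : f.ProperMinorsLinear) (hn : 2 ≤ f.E.card) {e : α}
    (he : e ∈ f.E) {X Y : Finset α} (hX : X ⊆ f.E.erase e) (hY : Y ⊆ f.E.erase e)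
    (h1 : f.f X + f.f (insert e X) ≠ 0) (h2 : f.f Y + f.f (insert e Y) ≠ 0) :
    f.f (symmDiff X Y) + f.f (insert e (symmDiff X Y)) ≠ 0 := by
  have h0 := hf.one_add_ne_zero hn he
  have h1 := (hf.add_insert_eq hn he hX).resolve_left h1
  have h2 := (hf.add_insert_eq hn he hY).resolve_left h2
  have := (hf.delete_linear hn he).2 X hX Y hY
    (by rw [delete_f_eq _ h0, h1, div_self h0]) (by rw [delete_f_eq _ h0, h2, div_self h0])
  rw [delete_f_eq _ h0, div_eq_one_iff_eq h0] at this
  rwa [this]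

theorem erase_eq_zero_or_one (hf : f.ProperMinorsLinear) {e : α} (he : e ∈ f.E) :
    f.f (f.E.erase e) = 0 ∨ f.f (f.E.erase e) = 1 :=
  hf.eq_zero_or_one (Finset.erase_ssubset he)

theorem erase_add_eq (hf : f.ProperMinorsLinear) (hn : 2 ≤ f.E.card) {e : α} (he : e ∈ f.E) :
    f.f (f.E.erase e) + f.f f.E = 0 ∨ f.f (f.E.erase e) + f.f f.E = 1 + f.f {e} := by
  simpa [Finset.insert_erase he] using hf.add_insert_eq hn he subset_rfl

theorem f_erase_of_f_E_eq_neg_one (hf : f.ProperMinorsLinear) (hn : 2 ≤ f.E.card)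
    (ht : f.f f.E = -1) {e : α} (he : e ∈ f.E) : f.f (f.E.erase e) = 1 := by
  have h1 := hf.erase_add_eq hn he
  rcases hf.erase_eq_zero_or_one he with h | h
  · rcases hf.singleton_eq hn he with h' | h' <;> rw [h, ht, h'] at h1 <;> norm_num at h1
  · exact h

/-- If `f E = -1` and the order is at least three, every pair and every singleton has value `0`. -/
theorem pair_eq_zero (hf : f.ProperMinorsLinear) (hn : 3 ≤ f.E.card) (ht : f.f f.E = -1)
    {c d : α} (hc : c ∈ f.E) (hd : d ∈ f.E) (hcd : c ≠ d) :
    f.f {d} = 0 ∧ f.f {c, d} = 0 := by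
  have herase : ∀ e ∈ f.E, f.f (f.E.erase e) = 1 :=
    fun e he => hf.f_erase_of_f_E_eq_neg_one (by omega) ht he
  have hdc : d ∈ f.E.erase c := Finset.mem_erase.2 ⟨hcd.symm, hd⟩
  have hlt : ({c, d} : Finset α) ⊂ f.E := by
    refine Finset.ssubset_iff_subset_ne.2 ⟨by simp [Finset.insert_subset_iff, hc, hd], fun h => ?_⟩
    rw [← h, Finset.card_pair hcd] at hn
    omega
  have hsum : f.f {d} + f.f (insert c {d}) = 0 := by
    by_contra hne
    have hX : ({d} : Finset α) ⊆ f.E.erase c := by simpa using hdc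
    have hY : (f.E.erase c).erase d ⊆ f.E.erase c := Finset.erase_subset _ _
    have hY' : f.f ((f.E.erase c).erase d) + f.f (insert c ((f.E.erase c).erase d)) ≠ 0 := by
      have e1 : insert c ((f.E.erase c).erase d) = f.E.erase d := by
        ext x; simp only [Finset.mem_insert, Finset.mem_erase]; grind
      rw [e1, herase d hd]
      have : (f.E.erase c).erase d ⊂ f.E :=
        (Finset.erase_subset _ _).trans_ssubset (Finset.erase_ssubset hc)
      rcases hf.eq_zero_or_one this with h | h <;> rw [h] <;> norm_num
    refine hf.add_insert_symmDiff_ne_zero (by omega) hc hX hY hne hY' ?_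
    rw [symmDiff_singleton_of_notMem (Finset.notMem_erase _ _), Finset.insert_erase hdc,
      Finset.insert_erase hc, herase c hc, ht]
    norm_num
  rcases hf.singleton_eq (by omega) hd with h | h <;>
    rcases hf.eq_zero_or_one hlt with h' | h' <;> rw [h, h'] at hsum <;> norm_num at hsum
  exact ⟨h, h'⟩

theorem isExcluded_of_f_E_eq_neg_one (hf : f.ProperMinorsLinear) (hn : 2 ≤ f.E.card)
    (ht : f.f f.E = -1) : f.IsExcluded := by
  have herase : ∀ e ∈ f.E, f.f (f.E.erase e) = 1 :=
    fun e he => hf.f_erase_of_f_E_eq_neg_one hn ht he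
  rcases hn.eq_or_lt with h2 | h3
  · obtain ⟨a, b, hab, hE⟩ := Finset.card_eq_two.1 h2.symm
    refine Or.inr (Or.inl ⟨a, b, hab, .of_eqOn hE fun X hX => ?_⟩)
    simp only [gTwo]
    split_ifs with hc
    · rw [Finset.eq_of_subset_of_card_le hX (by omega), ht]
    · have hXE : X ≠ f.E := fun h => hc (h ▸ h2.symm)
      obtain ⟨e, he, heX⟩ := Finset.exists_of_ssubset (Finset.ssubset_iff_subset_ne.2 ⟨hX, hXE⟩)
      rcases X.eq_empty_or_nonempty with rfl | hne
      · exact f.empty_one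
      · have hX' : X = f.E.erase e := by
          refine Finset.eq_of_subset_of_card_le (Finset.subset_erase.2 ⟨hX, heX⟩) ?_
          rw [Finset.card_erase_of_mem he]
          have := hne.card_pos
          omega
        rw [hX', herase e he]
  · have hzero : ∀ c ∈ f.E, ∀ d ∈ f.E, c ≠ d → f.f {d} = 0 ∧ f.f {c, d} = 0 :=
      fun c hc d hd hcd => hf.pair_eq_zero h3 ht hc hd hcd
    have hsing : ∀ d ∈ f.E, f.f {d} = 0 := by
      intro d hd
      obtain ⟨c, hc, hcd⟩ := Finset.exists_mem_ne (by omega : 1 < f.E.card) d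
      exact (hzero c hc d hd hcd).1
    have h4 : f.E.card ≠ 3 := by
      intro h
      obtain ⟨a, b, c, hab, hac, hbc, hE⟩ := Finset.card_eq_three.1 h
      have ha := herase a (by simp [hE])
      have : f.E.erase a = {b, c} := by rw [hE]; ext x; simp; grind
      rw [this, (hzero b (by simp [hE]) c (by simp [hE]) hbc).2] at ha
      norm_num at ha
    -- every triple has value one
    have htriple : ∀ a ∈ f.E, ∀ b ∈ f.E, ∀ c ∈ f.E, a ≠ b → a ≠ c → b ≠ c →
        f.f {a, b, c} = 1 := by
      intro a ha b hb c hc hab hac hbc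
      have key : ∀ x ∈ f.E, x ≠ a →
          f.f ((f.E.erase a).erase x) + f.f (insert a ((f.E.erase a).erase x)) ≠ 0 := by
        intro x hx hxa
        have e1 : insert a ((f.E.erase a).erase x) = f.E.erase x := by
          ext y; simp only [Finset.mem_insert, Finset.mem_erase]; grind
        rw [e1, herase x hx]
        have : (f.E.erase a).erase x ⊂ f.E :=
          (Finset.erase_subset _ _).trans_ssubset (Finset.erase_ssubset ha)
        rcases hf.eq_zero_or_one this with h | h <;> rw [h] <;> norm_num
      have h := hf.add_insert_symmDiff_ne_zero hn ha (Finset.erase_subset b _)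
        (Finset.erase_subset c _) (key b hb hab.symm) (key c hc hac.symm)
      have e2 : symmDiff ((f.E.erase a).erase b) ((f.E.erase a).erase c) = {b, c} := by
        ext y; simp only [Finset.mem_symmDiff, Finset.mem_erase, Finset.mem_insert,
          Finset.mem_singleton]; grind
      rw [e2, (hzero b hb c hc hbc).2, zero_add] at h
      refine (hf.eq_zero_or_one (Finset.ssubset_iff_subset_ne.2
        ⟨by simp [Finset.insert_subset_iff, ha, hb, hc], fun h' => h4 ?_⟩)).resolve_left h
      rw [← h']
      exact Finset.card_eq_three.2 ⟨a, b, c, hab, hac, hbc, rfl⟩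
    obtain ⟨S, hSE, hS⟩ := Finset.exists_subset_card_eq (by omega : 4 ≤ f.E.card)
    obtain ⟨a, b, c, d, hab, hac, had, hbc, hbd, hcd, rfl⟩ := Finset.card_eq_four.1 hS
    obtain ⟨ha, hb, hc, hd⟩ : a ∈ f.E ∧ b ∈ f.E ∧ c ∈ f.E ∧ d ∈ f.E := by
      simpa [Finset.insert_subset_iff] using hSE
    have hE : {a, b, c, d} = f.E := by
      by_contra hne
      obtain ⟨e, he, heS⟩ :=
        Finset.exists_of_ssubset (Finset.ssubset_iff_subset_ne.2 ⟨hSE, hne⟩)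
      have h1 := hf.symmDiff_eq_one he (X := {a, b, c}) (Y := {a, b, d})
        (Finset.subset_erase.2 ⟨by simp [Finset.insert_subset_iff, ha, hb, hc], by grind⟩)
        (Finset.subset_erase.2 ⟨by simp [Finset.insert_subset_iff, ha, hb, hd], by grind⟩)
        (htriple a ha b hb c hc hab hac hbc) (htriple a ha b hb d hd hab had hbd)
      have e1 : symmDiff ({a, b, c} : Finset α) {a, b, d} = {c, d} := by
        ext y; simp only [Finset.mem_symmDiff, Finset.mem_insert, Finset.mem_singleton]; grind
      rw [e1, (hzero c hc d hd hcd).2] at h1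
      norm_num at h1
    refine Or.inr (Or.inr ⟨a, b, c, d, hS, .of_eqOn hE.symm fun X hX => ?_⟩)
    have hE4 : f.E.card = 4 := hE ▸ hS
    have hle := Finset.card_le_card hX
    simp only [fU24]
    split_ifs with h0 h2 h3
    · rw [Finset.card_eq_zero.1 h0, f.empty_one]
    · obtain h1 | h2 : X.card = 1 ∨ X.card = 2 := by omega
      · obtain ⟨x, rfl⟩ := Finset.card_eq_one.1 h1
        exact hsing x (by simpa using hX)
      · obtain ⟨x, y, hxy, rfl⟩ := Finset.card_eq_two.1 h2
        exact (hzero x (hX (by simp)) y (hX (by simp)) hxy).2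
    · obtain ⟨x, y, z, hxy, hxz, hyz, rfl⟩ := Finset.card_eq_three.1 h3
      exact htriple x (hX (by simp)) y (hX (by simp)) z (hX (by simp)) hxy hxz hyz
    · rw [Finset.eq_of_subset_of_card_le hX (by omega), ht]

/-- A function invariant under adding an element `e` inherits linearity from its contraction. -/
theorem linear_of_insert_eq (hf : f.ProperMinorsLinear) {e : α} (he : e ∈ f.E)
    (h : ∀ W ⊆ f.E.erase e, f.f (insert e W) = f.f W) : f.Linear := by
  have hr : ∀ X ⊆ f.E, f.f X = f.f (X.erase e) := by
    intro X hX
    by_cases heX : e ∈ X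
    · rw [← h _ (Finset.erase_subset_erase e hX), Finset.insert_erase heX]
    · rw [Finset.erase_eq_of_notMem heX]
  refine ⟨fun X hX => ?_, fun X hX Y hY h1 h2 => ?_⟩
  · rw [hr X hX]
    exact (hf.contract e he).1 _ (Finset.erase_subset_erase e hX)
  · rw [hr _ (symmDiff_le_sup.trans (Finset.union_subset hX hY))]
    rw [hr X hX] at h1
    rw [hr Y hY] at h2
    have := hf.symmDiff_eq_one he (Finset.erase_subset_erase e hX)
      (Finset.erase_subset_erase e hY) h1 h2
    convert this using 2
    ext x; simp only [Finset.mem_symmDiff, Finset.mem_erase]; grind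

/-- A function complemented by adding any element is the indicator of even cardinality. -/
theorem linear_of_add_insert_eq_one
    (h : ∀ e ∈ f.E, ∀ W ⊆ f.E.erase e, f.f W + f.f (insert e W) = 1) : f.Linear := by
  have hpar : ∀ X : Finset α, X ⊆ f.E → f.f X = if Even X.card then 1 else 0 := by
    intro X
    induction X using Finset.induction_on with
    | empty => simp [f.empty_one]
    | insert a s has ih =>
      intro hs
      obtain ⟨ha, hs⟩ := Finset.insert_subset_iff.1 hs
      have h1 := h a ha s (Finset.subset_erase.2 ⟨hs, has⟩)
      rw [ih hs] at h1
      simp only [Finset.card_insert_of_notMem has, Nat.even_add_one]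
      split_ifs at h1 ⊢ <;> linarith
  refine ⟨fun X hX => ?_, fun X hX Y hY h1 h2 => ?_⟩
  · rw [hpar X hX]; split_ifs <;> simp
  · rw [hpar X hX] at h1
    rw [hpar Y hY] at h2
    rw [hpar _ (symmDiff_le_sup.trans (Finset.union_subset hX hY)), if_pos]
    have hXe : Even X.card := by by_contra h; simp [h] at h1
    have hYe : Even Y.card := by by_contra h; simp [h] at h2
    have e1 := Finset.card_sdiff_add_card_inter X Y
    have e2 := Finset.card_sdiff_add_card_inter Y X
    have e3 : (symmDiff X Y).card = (X \ Y).card + (Y \ X).card :=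
      Finset.card_union_of_disjoint disjoint_sdiff_sdiff
    rw [Finset.inter_comm] at e2
    rw [e3]
    rw [Nat.even_iff] at *
    omega

theorem f_E_eq_neg_one_of_singleton_eq_one (hf : f.ProperMinorsLinear) (hn : 2 ≤ f.E.card)
    (hnl : ¬ f.Linear) {e : α} (he : e ∈ f.E) (h1 : f.f {e} = 1) : f.f f.E = -1 := by
  have hlt : ∀ W ⊂ f.E.erase e, f.f (insert e W) = f.f W := by
    intro W hW
    have hW' : insert e W ⊂ f.E := by
      obtain ⟨x, hx, hxW⟩ := Finset.exists_of_ssubset hW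
      refine Finset.ssubset_iff_subset_ne.2 ⟨Finset.insert_subset he
        (hW.1.trans (Finset.erase_subset _ _)), fun h => ?_⟩
      rw [← h] at hx
      grind
    have := hf.add_insert_eq hn he hW.1
    rw [h1] at this
    rcases hf.eq_zero_or_one hW' with h | h <;>
      rcases hf.eq_zero_or_one (hW.trans (Finset.erase_ssubset he)) with h' | h' <;>
      rw [h, h'] at this <;> norm_num at this <;> rw [h, h']
  have hne : f.f f.E ≠ f.f (f.E.erase e) := by
    intro h
    refine hnl (hf.linear_of_insert_eq he fun W hW => ?_)
    rcases hW.eq_or_ssubset with rfl | hW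
    · rw [Finset.insert_erase he, h]
    · exact hlt W hW
  have hsum := hf.erase_add_eq hn he
  rw [h1] at hsum
  rcases hf.erase_eq_zero_or_one he with h | h <;> rw [h] at hne hsum
  · have ht : f.f f.E = 2 := by
      rcases hsum with h' | h'
      · exact absurd (by linarith) hne
      · linarith
    exfalso
    have hsing : ∀ x ∈ f.E, f.f {x} = 1 := by
      intro x hx
      refine (hf.singleton_eq hn hx).resolve_left fun hx0 => ?_
      have hx1 := hf.erase_add_eq hn hx
      rw [hx0, ht] at hx1
      rcases hf.erase_eq_zero_or_one hx with h' | h' <;> rw [h'] at hx1 <;> norm_num at hx1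
    have hone : ∀ X : Finset α, X ⊆ f.E.erase e → f.f X = 1 := by
      intro X
      induction X using Finset.induction_on with
      | empty => exact fun _ => f.empty_one
      | insert a s has ih =>
        intro hs
        obtain ⟨ha, hs⟩ := Finset.insert_subset_iff.1 hs
        rw [← symmDiff_singleton_of_notMem has]
        exact hf.symmDiff_eq_one he (by simpa using ha) hs
          (hsing a (Finset.mem_of_mem_erase ha)) (ih hs)
    rw [hone _ subset_rfl] at h
    norm_num at h
  · rcases hsum with h' | h'
    · linarith
    · exact absurd (by linarith) hne

theorem linear_of_singletons_eq_zero (hf : f.ProperMinorsLinear) (hn : 2 ≤ f.E.card)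
    (h0 : ∀ e ∈ f.E, f.f {e} = 0) (ht : f.f f.E = 0 ∨ f.f f.E = 1) : f.Linear := by
  have hbin : ∀ X ⊆ f.E, f.f X = 0 ∨ f.f X = 1 := by
    intro X hX
    rcases hX.eq_or_ssubset with rfl | hX
    · exact ht
    · exact hf.eq_zero_or_one hX
  by_contra hnl
  obtain ⟨X, hX, Y, hY, h1, h2, h3⟩ : ∃ X ⊆ f.E, ∃ Y ⊆ f.E, f.f X = 1 ∧ f.f Y = 1 ∧
      f.f (symmDiff X Y) ≠ 1 := by
    by_contra hcon
    push Not at hcon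
    exact hnl ⟨hbin, hcon⟩
  set Z := symmDiff X Y with hZdef
  have hZ : Z ⊆ f.E := symmDiff_le_sup.trans (Finset.union_subset hX hY)
  -- a set in the support of `f` stays in the support after deleting `e`
  have hsupp : ∀ e ∈ f.E, ∀ X ⊆ f.E, f.f X = 1 →
      f.f (X.erase e) + f.f (insert e (X.erase e)) ≠ 0 := by
    intro e he X hX hX1
    by_cases heX : e ∈ X
    · rw [Finset.insert_erase heX, hX1]
      rcases hbin _ ((Finset.erase_subset e X).trans hX) with h | h <;> rw [h] <;> norm_num
    · rw [Finset.erase_eq_of_notMem heX, hX1]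
      rcases hbin _ (Finset.insert_subset he hX) with h | h <;> rw [h] <;> norm_num
  have hZe : ∀ e ∈ f.E, f.f (Z.erase e) + f.f (insert e (Z.erase e)) ≠ 0 := by
    intro e he
    have := hf.add_insert_symmDiff_ne_zero hn he (Finset.erase_subset_erase e hX)
      (Finset.erase_subset_erase e hY) (hsupp e he X hX h1) (hsupp e he Y hY h2)
    have e1 : symmDiff (X.erase e) (Y.erase e) = Z.erase e := by
      rw [hZdef]
      ext x; simp only [Finset.mem_symmDiff, Finset.mem_erase]; grind
    rwa [e1] at this
  have hZ0 : f.f Z = 0 := (hbin Z hZ).resolve_right h3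
  have hflip : ∀ e ∈ f.E, f.f (symmDiff Z {e}) = 1 := by
    intro e he
    have hs := hZe e he
    have hmem : symmDiff Z {e} ⊆ f.E :=
      symmDiff_le_sup.trans (Finset.union_subset hZ (by simpa using he))
    refine (hbin _ hmem).resolve_left fun h => hs ?_
    by_cases heZ : e ∈ Z
    · have e1 : symmDiff Z {e} = Z.erase e := by
        ext x; simp only [Finset.mem_symmDiff, Finset.mem_erase, Finset.mem_singleton]; grind
      rw [Finset.insert_erase heZ, hZ0, ← e1, h, zero_add]
    · rw [Finset.erase_eq_of_notMem heZ, hZ0, ← symmDiff_singleton_of_notMem heZ, symmDiff_comm,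
        h, zero_add]
  refine hnl (linear_of_add_insert_eq_one fun e he => ?_)
  have hsing : ∀ x ∈ f.E.erase e, f.f {x} + f.f (insert e {x}) ≠ 0 := by
    intro x hx
    have hxE := Finset.mem_of_mem_erase hx
    have hmem : symmDiff Z {x} ⊆ f.E :=
      symmDiff_le_sup.trans (Finset.union_subset hZ (by simpa using hxE))
    have := hf.add_insert_symmDiff_ne_zero hn he (Finset.erase_subset_erase e hZ)
      (Finset.erase_subset_erase e hmem) (hZe e he) (hsupp e he _ hmem (hflip x hxE))
    have e1 : symmDiff (Z.erase e) ((symmDiff Z {x}).erase e) = {x} := by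
      have := Finset.ne_of_mem_erase hx
      ext y; simp only [Finset.mem_symmDiff, Finset.mem_erase, Finset.mem_singleton]; grind
    rwa [e1] at this
  have hall : ∀ W : Finset α, W ⊆ f.E.erase e → f.f W + f.f (insert e W) ≠ 0 := by
    intro W
    induction W using Finset.induction_on with
    | empty =>
      intro _
      simp [f.empty_one, h0 e he]
    | insert a s has ih =>
      intro hs
      obtain ⟨ha, hs⟩ := Finset.insert_subset_iff.1 hs
      rw [← symmDiff_singleton_of_notMem has]
      exact hf.add_insert_symmDiff_ne_zero hn he (by simpa using ha) hs (hsing a ha) (ih hs)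
  intro W hW
  simpa [h0 e he] using (hf.add_insert_eq hn he hW).resolve_left (hall W hW)

theorem isExcluded (hf : f.ProperMinorsLinear) (hnl : ¬ f.Linear) : f.IsExcluded := by
  rcases Nat.lt_or_ge f.E.card 2 with hlt | hn
  · have hempty : f.E ≠ ∅ := by
      intro h
      refine hnl ⟨fun X hX => ?_, fun X hX Y hY _ _ => ?_⟩
      · rw [h, Finset.subset_empty] at hX
        simp [hX, f.empty_one]
      · rw [h, Finset.subset_empty] at hX hY
        simp [hX, hY, f.empty_one]
    have hpos := (Finset.nonempty_iff_ne_empty.2 hempty).card_pos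
    obtain ⟨e, hE⟩ := Finset.card_eq_one.1 (by omega : f.E.card = 1)
    have hval : ¬ (f.f {e} = 0 ∨ f.f {e} = 1) := by
      intro hv
      refine hnl ⟨fun X hX => ?_, fun X hX Y hY h1 h2 => ?_⟩
      · rw [hE, Finset.subset_singleton_iff] at hX
        rcases hX with rfl | rfl
        · exact Or.inr f.empty_one
        · exact hv
      · rw [hE, Finset.subset_singleton_iff] at hX hY
        rcases hX with rfl | rfl <;> rcases hY with rfl | rfl <;>
          simp [← Finset.bot_eq_empty, h1, h2]
        all_goals simpa using f.empty_one
    refine Or.inl ⟨e, f.f {e}, fun h => hval (Or.inl h), fun h => hval (Or.inr h),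
      .of_eqOn hE fun X hX => ?_⟩
    rw [hE, Finset.subset_singleton_iff] at hX
    rcases hX with rfl | rfl <;> simp [fAlpha, f.empty_one]
  · refine hf.isExcluded_of_f_E_eq_neg_one hn ?_
    by_cases hex : ∃ e ∈ f.E, f.f {e} = 1
    · obtain ⟨e, he, h1⟩ := hex
      exact hf.f_E_eq_neg_one_of_singleton_eq_one hn hnl he h1
    · have h0 : ∀ e ∈ f.E, f.f {e} = 0 := fun e he =>
        (hf.singleton_eq hn he).resolve_right fun h => hex ⟨e, he, h⟩
      by_contra hne
      refine hnl (hf.linear_of_singletons_eq_zero hn h0 ?_)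
      obtain ⟨e, he⟩ := Finset.card_pos.1 (by omega : 0 < f.E.card)
      have hsum := hf.erase_add_eq hn he
      rw [h0 e he, add_zero] at hsum
      rcases hf.erase_eq_zero_or_one he with h | h <;> rw [h] at hsum
      · simpa using hsum
      · rcases hsum with h' | h'
        · exact absurd (by linarith) hne
        · left; linarith

end ProperMinorsLinear

theorem exists_isExcluded_minor (f : BinaryFunction α) (hnl : ¬ f.Linear) :
    ∃ m : BinaryFunction α, IsMinorOf m f ∧ m.IsExcluded := by
  induction hn : f.E.card using Nat.strong_induction_on generalizing f with
  | _ n ih =>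
    by_cases hf : f.ProperMinorsLinear
    · exact ⟨f, .refl f, hf.isExcluded hnl⟩
    · obtain ⟨g, hgf, hcard, hg⟩ : ∃ g : BinaryFunction α,
          IsMinorOf g f ∧ g.E.card < n ∧ ¬ g.Linear := by
        by_contra hcon
        push Not at hcon
        exact hf ⟨fun e he => hcon _ (.contract e he (.refl f))
            (hn ▸ Finset.card_erase_lt_of_mem he),
          fun e he hw => hcon _ (.delete e he hw (.refl f))
            (hn ▸ Finset.card_erase_lt_of_mem he)⟩
      obtain ⟨m, hm, hex⟩ := ih _ hcard g hg rfl
      exact ⟨m, hm.trans hgf, hex⟩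

end BinaryFunction

open BinaryFunction in
/-- A binary function is linear iff it has no minor isomorphic to
`f_α` (`α ∉ {0,1}`), the order-two function `g`, or `f_{U_{2,4}}`. -/
theorem linear_iff_no_excluded_minor {α : Type} [DecidableEq α] (f : BinaryFunction α) :
    f.Linear ↔
      ¬ ∃ m : BinaryFunction α, IsMinorOf m f ∧
          ((∃ (e : α) (a : ℝ), a ≠ 0 ∧ a ≠ 1 ∧ m.Isomorphic (fAlpha e a)) ∨
           (∃ a b : α, a ≠ b ∧ m.Isomorphic (gTwo a b)) ∨
           (∃ a b c d : α, ({a, b, c, d} : Finset α).card = 4 ∧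
             m.Isomorphic (fU24 a b c d))) := by
  refine ⟨fun hf ⟨m, hm, hex⟩ => ?_, fun h => ?_⟩
  · exact IsExcluded.not_linear hex (hf.of_isMinorOf hm)
  · by_contra hnl
    exact h (exists_isExcluded_minor f hnl)
end

section
/- A binary function is 1-polymatroidal (matroidal) if and only if it has no minor isomorphic to any of the following: (i) f_α for any α ∈ ℝ∖{0,1}; (ii) the order-two binary function g on ground set {a,b} with g(X)=1 for |X| ∈ {0,1} and g(X)=−1 for |X|=2. -/
namespace BinaryFunction

variable {α : Type} [DecidableEq α]

/-- The sum of `g` over the subsets of `A`. -/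
def subsetSum (g : BinaryFunction α) (A : Finset α) : ℝ :=
  ∑ Y ∈ A.powerset, g.f Y

@[simp]
lemma subsetSum_empty (g : BinaryFunction α) : g.subsetSum ∅ = 1 := by
  simp [subsetSum, g.empty_one]

@[simp]
lemma subsetSum_singleton (g : BinaryFunction α) (e : α) :
    g.subsetSum {e} = 1 + g.f {e} := by
  have h := Finset.sum_powerset_insert (Finset.notMem_empty e) g.f
  simpa [subsetSum, g.empty_one] using h

lemma subsetSum_pair (g : BinaryFunction α) {a b : α} (hab : a ≠ b) :
    g.subsetSum {a, b} = 1 + g.f {b} + g.f {a} + g.f {a, b} := by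
  have h := Finset.sum_powerset_insert (s := {b}) (a := a) (by simpa using hab) g.f
  have h' := Finset.sum_powerset_insert (Finset.notMem_empty b) g.f
  have h'' := Finset.sum_powerset_insert (Finset.notMem_empty b) (fun t => g.f (insert a t))
  simp only [Finset.powerset_empty, Finset.sum_singleton, g.empty_one,
    insert_empty_eq] at h' h''
  rw [subsetSum, h, h', h'']
  ring

lemma subsetSum_delete_mul (g : BinaryFunction α) {e : α} {A : Finset α} (he : e ∉ A)
    (hw : 1 + g.f {e} ≠ 0) :
    (g.delete e).subsetSum A * (1 + g.f {e}) = g.subsetSum (insert e A) := by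
  rw [subsetSum, subsetSum, Finset.sum_powerset_insert he, Finset.sum_mul,
    ← Finset.sum_add_distrib]
  refine Finset.sum_congr rfl fun Y _ => ?_
  rcases eq_or_ne Y ∅ with rfl | hY
  · simp [delete, g.empty_one]
  · simp only [delete, hY, if_false]
    rw [div_mul_cancel₀ _ hw, Finset.union_comm, ← Finset.insert_eq]

/-- Every minor rescales the subset sums of the original function over a deleted set. -/
lemma IsMinorOf.exists_deleted {m f : BinaryFunction α} (h : IsMinorOf m f) :
    m.E ⊆ f.E ∧ ∃ D ⊆ f.E, Disjoint D m.E ∧ f.subsetSum D ≠ 0 ∧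
      ∀ A ⊆ m.E, m.subsetSum A * f.subsetSum D = f.subsetSum (A ∪ D) := by
  induction h with
  | refl f => exact ⟨subset_rfl, ∅, by simp⟩
  | contract e he _ ih =>
    obtain ⟨hE, D, hD, hdis, h0, hA⟩ := ih
    exact ⟨(Finset.erase_subset _ _).trans hE, D, hD,
      hdis.mono_right (Finset.erase_subset _ _), h0,
      fun A hAE => hA A (hAE.trans (Finset.erase_subset _ _))⟩
  | @delete f g e he hw _ ih =>
    obtain ⟨hE, D, hD, hdis, h0, hA⟩ := ih
    have hsum : f.subsetSum (insert e D) = (1 + g.f {e}) * f.subsetSum D := by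
      rw [Finset.insert_eq, ← hA {e} (by simpa using he), subsetSum_singleton]
    refine ⟨(Finset.erase_subset _ _).trans hE, insert e D,
      Finset.insert_subset (hE he) hD, ?_, hsum ▸ mul_ne_zero hw h0, fun A hAE => ?_⟩
    · exact Finset.disjoint_insert_left.2
        ⟨Finset.notMem_erase _ _, hdis.mono_right (Finset.erase_subset _ _)⟩
    · have heA : e ∉ A := fun h => Finset.notMem_erase e g.E (hAE h)
      have hAg : insert e A ⊆ g.E :=
        Finset.insert_subset he (hAE.trans (Finset.erase_subset _ _))
      rw [hsum, ← mul_assoc, subsetSum_delete_mul g heA hw, hA _ hAg,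
        Finset.insert_union, Finset.union_insert]

/-- Contracting the complement of `B` restricts the ground set to `B`. -/
lemma IsMinorOf.exists_restrict {m f : BinaryFunction α} (h : IsMinorOf m f)
    {B : Finset α} (hB : B ⊆ m.E) : ∃ m', IsMinorOf m' f ∧ m'.E = B ∧ m'.f = m.f := by
  suffices H : ∀ C : Finset α, C ⊆ m.E →
      ∃ m', IsMinorOf m' f ∧ m'.E = m.E \ C ∧ m'.f = m.f by
    obtain ⟨m', h₁, h₂, h₃⟩ := H (m.E \ B) Finset.sdiff_subset
    exact ⟨m', h₁, by rw [h₂, Finset.sdiff_sdiff_eq_self hB], h₃⟩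
  intro C
  induction C using Finset.induction_on with
  | empty => exact fun _ => ⟨m, h, by simp, rfl⟩
  | insert e C he ih =>
    intro hC
    obtain ⟨heE, hCE⟩ := Finset.insert_subset_iff.1 hC
    obtain ⟨m', h₁, h₂, h₃⟩ := ih hCE
    refine ⟨m'.contract e, .contract e (by simp [h₂, heE, he]) h₁, ?_, h₃⟩
    simp [BinaryFunction.contract, h₂, Finset.sdiff_insert]

/-- Adding an element to a subset of the ground set preserves or doubles the subset sum. -/
def SubsetSumDoubling (f : BinaryFunction α) : Prop :=
  ∀ D ⊆ f.E, ∀ e ∈ f.E, e ∉ D →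
    f.subsetSum (insert e D) = f.subsetSum D ∨ f.subsetSum (insert e D) = 2 * f.subsetSum D

/-- No two elements each double a subset sum that they together only double. -/
def NoParallelDoubling (f : BinaryFunction α) : Prop :=
  ∀ D ⊆ f.E, ∀ a ∈ f.E, ∀ b ∈ f.E, a ∉ D → b ∉ D → a ≠ b →
    ¬ (f.subsetSum (insert a D) = 2 * f.subsetSum D ∧
       f.subsetSum (insert b D) = 2 * f.subsetSum D ∧
       f.subsetSum (insert a (insert b D)) = 2 * f.subsetSum D)

lemma SubsetSumDoubling.subsetSum_pos {f : BinaryFunction α} (h : f.SubsetSumDoubling)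
    {D : Finset α} (hD : D ⊆ f.E) : 0 < f.subsetSum D := by
  induction D using Finset.induction_on with
  | empty => simp
  | insert e D he ih =>
    obtain ⟨heE, hDE⟩ := Finset.insert_subset_iff.1 hD
    have := ih hDE
    rcases h D hDE e heE he with h' | h' <;> rw [h'] <;> linarith

lemma Q_eq {f : BinaryFunction α} (hpos : ∀ D ⊆ f.E, 0 < f.subsetSum D) (X : Finset α) :
    f.Q X = Real.logb 2 (f.subsetSum f.E) - Real.logb 2 (f.subsetSum (f.E \ X)) :=
  Real.logb_div (hpos _ subset_rfl).ne' (hpos _ Finset.sdiff_subset).ne'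

lemma Q_sdiff {f : BinaryFunction α} (hpos : ∀ D ⊆ f.E, 0 < f.subsetSum D)
    {D : Finset α} (hD : D ⊆ f.E) :
    f.Q (f.E \ D) = Real.logb 2 (f.subsetSum f.E) - Real.logb 2 (f.subsetSum D) := by
  rw [Q_eq hpos, Finset.sdiff_sdiff_eq_self hD]

lemma Rankable.subsetSum_pos {f : BinaryFunction α} (h : f.Rankable)
    {D : Finset α} (hD : D ⊆ f.E) : 0 < f.subsetSum D := by
  have hE : 0 < f.subsetSum f.E := by
    have h' : 0 < f.subsetSum f.E / f.subsetSum (f.E \ f.E) := (h f.E subset_rfl).2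
    simpa using h'
  have h' : 0 < f.subsetSum f.E / f.subsetSum (f.E \ (f.E \ D)) :=
    (h (f.E \ D) Finset.sdiff_subset).2
  rw [Finset.sdiff_sdiff_eq_self hD] at h'
  exact (div_pos_iff_of_pos_left hE).1 h'

lemma Polymatroidal.Q_insert_le {f : BinaryFunction α} (h : f.Polymatroidal 1)
    {X : Finset α} (hX : X ⊆ f.E) {e : α} (he : e ∈ f.E) (heX : e ∉ X) :
    f.Q (insert e X) ≤ f.Q X + 1 := by
  obtain ⟨hr, -, h₁, -, h₃⟩ := h
  induction X using Finset.induction_on with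
  | empty =>
    have h' := h₁ {e} (by simpa using he)
    have h0 : f.Q ∅ = 0 := by
      rw [Q_eq fun _ hD => hr.subsetSum_pos hD]
      simp
    simpa [h0] using h'
  | insert a X ha ih =>
    obtain ⟨haE, hXE⟩ := Finset.insert_subset_iff.1 hX
    have hea : e ≠ a := fun h => heX (by simp [h])
    have heX' : e ∉ X := fun h => heX (by simp [h])
    linarith [ih hXE heX', h₃ X hXE e he a haE heX' ha hea]

lemma sdiff_eq_insert_sdiff_insert {E D : Finset α} {e : α} (he : e ∈ E) (heD : e ∉ D) :
    E \ D = insert e (E \ insert e D) := by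
  ext x
  simp only [Finset.mem_sdiff, Finset.mem_insert]
  grind

lemma logb_two_mul {x : ℝ} (hx : 0 < x) : Real.logb 2 (2 * x) = Real.logb 2 x + 1 := by
  rw [Real.logb_mul two_ne_zero hx.ne', Real.logb_self_eq_one one_lt_two, add_comm]

lemma Polymatroidal.subsetSumDoubling {f : BinaryFunction α} (h : f.Polymatroidal 1) :
    f.SubsetSumDoubling := by
  intro D hD e he heD
  have hpos : ∀ D ⊆ f.E, 0 < f.subsetSum D := fun _ hD => h.1.subsetSum_pos hD
  have hD' : insert e D ⊆ f.E := Finset.insert_subset he hD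
  have hX : f.E \ insert e D ⊆ f.E := Finset.sdiff_subset
  have heX : e ∉ f.E \ insert e D := by simp
  have hle := h.Q_insert_le hX he heX
  obtain ⟨-, h₀, -, h₂, -⟩ := h
  have hge := h₂ _ hX e he heX
  rw [← sdiff_eq_insert_sdiff_insert he heD] at hle hge
  obtain ⟨n, hn⟩ := h₀ _ hX
  obtain ⟨k, hk⟩ := h₀ (f.E \ D) Finset.sdiff_subset
  rw [hn, hk] at hle hge
  have hle' : k ≤ n + 1 := by exact_mod_cast hle
  have hge' : n ≤ k := by exact_mod_cast hge
  rw [Q_sdiff hpos hD] at hk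
  rw [Q_sdiff hpos hD'] at hn
  obtain rfl | rfl : k = n ∨ k = n + 1 := by omega
  · left
    exact Real.logb_injOn_pos one_lt_two (hpos _ hD') (hpos _ hD) (by linarith)
  · right
    refine Real.logb_injOn_pos one_lt_two (hpos _ hD') (mul_pos two_pos (hpos _ hD)) ?_
    rw [logb_two_mul (hpos _ hD)]
    push_cast at hk
    linarith

lemma Polymatroidal.noParallelDoubling {f : BinaryFunction α} (h : f.Polymatroidal 1) :
    f.NoParallelDoubling := by
  rintro D hD a ha b hb haD hbD hab ⟨h_a, h_b, h_ab⟩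
  have hpos : ∀ D ⊆ f.E, 0 < f.subsetSum D := fun _ hD => h.1.subsetSum_pos hD
  have hbD' : insert b D ⊆ f.E := Finset.insert_subset hb hD
  have haD' : insert a D ⊆ f.E := Finset.insert_subset ha hD
  have habD' : insert a (insert b D) ⊆ f.E := Finset.insert_subset ha hbD'
  have h₃ := h.2.2.2.2 (f.E \ insert a (insert b D)) Finset.sdiff_subset a ha b hb
    (by simp) (by simp) hab
  have e₁ : insert a (f.E \ insert a (insert b D)) = f.E \ insert b D :=
    (sdiff_eq_insert_sdiff_insert ha (by simp [hab, haD])).symm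
  have e₂ : insert b (f.E \ insert a (insert b D)) = f.E \ insert a D := by
    rw [Finset.insert_comm a b]
    exact (sdiff_eq_insert_sdiff_insert hb (by simp [hab.symm, hbD])).symm
  rw [e₂, e₁, ← sdiff_eq_insert_sdiff_insert ha haD, Q_sdiff hpos habD', Q_sdiff hpos hD,
    Q_sdiff hpos haD', Q_sdiff hpos hbD', h_a, h_b, h_ab, logb_two_mul (hpos _ hD)] at h₃
  linarith

lemma SubsetSumDoubling.Q_insert {f : BinaryFunction α} (h : f.SubsetSumDoubling)
    (X : Finset α) {e : α} (he : e ∈ f.E) (heX : e ∉ X) :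
    f.Q (insert e X) = f.Q X ∨ f.Q (insert e X) = f.Q X + 1 := by
  have hpos : ∀ D ⊆ f.E, 0 < f.subsetSum D := fun _ hD => h.subsetSum_pos hD
  have hsub : f.E \ insert e X ⊆ f.E := Finset.sdiff_subset
  have hdouble := h _ hsub e he (by simp)
  rw [← sdiff_eq_insert_sdiff_insert he heX] at hdouble
  rw [Q_eq hpos, Q_eq hpos]
  rcases hdouble with h' | h'
  · left
    rw [h']
  · right
    rw [h', logb_two_mul (hpos _ hsub)]
    ring

lemma polymatroidal_one_of_doubling {f : BinaryFunction α} (h : f.SubsetSumDoubling)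
    (h' : f.NoParallelDoubling) : f.Polymatroidal 1 := by
  have hpos : ∀ D ⊆ f.E, 0 < f.subsetSum D := fun _ hD => h.subsetSum_pos hD
  have hrank : ∀ X ⊆ f.E, ∃ n : ℕ, f.Q X = n ∧ n ≤ X.card := by
    intro X
    induction X using Finset.induction_on with
    | empty => exact fun _ => ⟨0, by simp [Q_eq hpos]⟩
    | insert e X he ih =>
      intro hX
      obtain ⟨heE, hXE⟩ := Finset.insert_subset_iff.1 hX
      obtain ⟨n, hn, hcard⟩ := ih hXE
      rw [Finset.card_insert_of_notMem he]
      rcases h.Q_insert X heE he with hQ | hQ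
      · exact ⟨n, by rw [hQ, hn], by omega⟩
      · exact ⟨n + 1, by rw [hQ, hn]; push_cast; rfl, by omega⟩
  refine ⟨fun X _ => ⟨(hpos _ Finset.sdiff_subset).ne',
    div_pos (hpos _ subset_rfl) (hpos _ Finset.sdiff_subset)⟩, fun X hX => ?_, fun X hX => ?_,
    fun X _ e he heX => ?_, fun X hX a ha b hb haX hbX hab => ?_⟩
  · obtain ⟨n, hn, -⟩ := hrank X hX
    exact ⟨n, hn⟩
  · obtain ⟨n, hn, hcard⟩ := hrank X hX
    rw [hn, Nat.cast_one, one_mul]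
    exact_mod_cast hcard
  · rcases h.Q_insert X he heX with hQ | hQ <;> linarith
  · by_contra! hlt
    have hbX' : b ∉ insert a X := by simp [hab.symm, hbX]
    have haX' : a ∉ insert b X := by simp [hab, haX]
    have hQa := h.Q_insert X ha haX
    have hQb := h.Q_insert X hb hbX
    have hQab := h.Q_insert (insert b X) ha haX'
    have hQba := h.Q_insert (insert a X) hb hbX'
    rw [Finset.insert_comm b a] at hQba
    obtain ⟨hQa, hQb, hQab⟩ : f.Q (insert a X) = f.Q X ∧ f.Q (insert b X) = f.Q X ∧
        f.Q (insert a (insert b X)) = f.Q X + 1 := by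
      rcases hQa with hQa | hQa <;> rcases hQb with hQb | hQb <;>
        rcases hQab with hQab | hQab <;> rcases hQba with hQba | hQba <;>
        refine ⟨?_, ?_, ?_⟩ <;> linarith
    set D := f.E \ insert a (insert b X) with hD
    have hDE : D ⊆ f.E := Finset.sdiff_subset
    have eb : insert a D = f.E \ insert b X := (sdiff_eq_insert_sdiff_insert ha haX').symm
    have ea : insert b D = f.E \ insert a X := by
      rw [hD, Finset.insert_comm a b]
      exact (sdiff_eq_insert_sdiff_insert hb hbX').symm
    have eab : insert a (insert b D) = f.E \ X := by
      rw [ea]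
      exact (sdiff_eq_insert_sdiff_insert ha haX).symm
    rw [Q_eq hpos (insert a (insert b X))] at hQab
    rw [Q_eq hpos X] at hQa hQb hQab
    rw [Q_eq hpos, ← ea] at hQa
    rw [Q_eq hpos, ← eb] at hQb
    rw [← eab] at hQa hQb hQab
    have key : ∀ A ⊆ f.E, Real.logb 2 (f.subsetSum A) = Real.logb 2 (f.subsetSum D) + 1 →
        f.subsetSum A = 2 * f.subsetSum D := fun A hA hlog =>
      Real.logb_injOn_pos one_lt_two (hpos _ hA) (mul_pos two_pos (hpos _ hDE))
        (by rw [hlog, logb_two_mul (hpos _ hDE)])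
    exact h' D hDE a ha b hb (by simp [hD]) (by simp [hD]) hab
      ⟨key _ (eb ▸ Finset.sdiff_subset) (by linarith),
        key _ (ea ▸ Finset.sdiff_subset) (by linarith),
        key _ (eab ▸ Finset.sdiff_subset) (by linarith)⟩

lemma polymatroidal_one_iff_doubling (f : BinaryFunction α) :
    f.Polymatroidal 1 ↔ f.SubsetSumDoubling ∧ f.NoParallelDoubling :=
  ⟨fun h => ⟨h.subsetSumDoubling, h.noParallelDoubling⟩,
    fun h => polymatroidal_one_of_doubling h.1 h.2⟩

lemma Isomorphic.exists_of_fAlpha {m : BinaryFunction α} {e : α} {a : ℝ}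
    (h : m.Isomorphic (fAlpha e a)) : ∃ x, m.E = {x} ∧ m.f {x} = a := by
  obtain ⟨φ, hinj, himg, hval⟩ := h
  have hcard : m.E.card = 1 := by
    rw [← Finset.card_image_of_injOn hinj, himg]
    simp [fAlpha]
  obtain ⟨x, hx⟩ := Finset.card_eq_one.1 hcard
  exact ⟨x, hx, by simpa [fAlpha] using hval {x} hx.ge⟩

lemma isomorphic_fAlpha {m : BinaryFunction α} {x : α} (hx : m.E = {x}) :
    m.Isomorphic (fAlpha x (m.f {x})) := by
  refine ⟨id, Function.injective_id.injOn, by simp [fAlpha, hx], fun X hX => ?_⟩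
  rw [hx, Finset.subset_singleton_iff] at hX
  rcases hX with rfl | rfl <;> simp [fAlpha, m.empty_one]

lemma Isomorphic.exists_of_gTwo {m : BinaryFunction α} {a b : α} (hab : a ≠ b)
    (h : m.Isomorphic (gTwo a b)) : ∃ x y, x ≠ y ∧ m.E = {x, y} ∧
      m.f {x} = 1 ∧ m.f {y} = 1 ∧ m.f {x, y} = -1 := by
  obtain ⟨φ, hinj, himg, hval⟩ := h
  have hcard : m.E.card = 2 := by
    rw [← Finset.card_image_of_injOn hinj, himg]
    exact Finset.card_pair hab
  obtain ⟨x, y, hxy, hE⟩ := Finset.card_eq_two.1 hcard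
  have hφ : φ x ≠ φ y := fun h => hxy (hinj (by simp [hE]) (by simp [hE]) h)
  refine ⟨x, y, hxy, hE, ?_, ?_, ?_⟩
  · simpa [gTwo] using hval {x} (by simp [hE])
  · simpa [gTwo] using hval {y} (by simp [hE])
  · simpa [gTwo, Finset.image_insert, Finset.card_pair hφ] using hval {x, y} hE.ge

lemma isomorphic_gTwo {m : BinaryFunction α} {x y : α} (hxy : x ≠ y) (hE : m.E = {x, y})
    (hx : m.f {x} = 1) (hy : m.f {y} = 1) (hxy' : m.f {x, y} = -1) :
    m.Isomorphic (gTwo x y) := by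
  refine ⟨id, Function.injective_id.injOn, by simp [gTwo, hE], fun X hX => ?_⟩
  rw [hE, ← Finset.mem_powerset] at hX
  have hX' : X = ∅ ∨ X = {y} ∨ X = {x} ∨ X = {x, y} := by
    simpa [Finset.powerset_insert, or_assoc, eq_comm (b := X)] using hX
  rcases hX' with rfl | rfl | rfl | rfl <;>
    simp [gTwo, m.empty_one, hx, hy, hxy', Finset.card_pair hxy]

/-- If no order-one minor is some `f_α` with `α ∉ {0,1}`, every subset of the ground set
can be deleted. -/
lemma exists_minor_deleting {f : BinaryFunction α}
    (h : ∀ m, IsMinorOf m f → ∀ e ∈ m.E, m.f {e} = 0 ∨ m.f {e} = 1)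
    {D : Finset α} (hD : D ⊆ f.E) :
    ∃ m, IsMinorOf m f ∧ m.E = f.E \ D ∧
      ∀ A ⊆ m.E, m.subsetSum A * f.subsetSum D = f.subsetSum (A ∪ D) := by
  induction D using Finset.induction_on with
  | empty => exact ⟨f, .refl f, by simp⟩
  | insert e D he ih =>
    obtain ⟨heE, hDE⟩ := Finset.insert_subset_iff.1 hD
    obtain ⟨m, hm, hmE, hA⟩ := ih hDE
    have hem : e ∈ m.E := by simp [hmE, heE, he]
    have hw : 1 + m.f {e} ≠ 0 := by
      rcases h m hm e hem with h' | h' <;> rw [h'] <;> norm_num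
    refine ⟨m.delete e, .delete e hem hw hm, ?_, fun A hAE => ?_⟩
    · simp [BinaryFunction.delete, hmE, Finset.sdiff_insert]
    · have heA : e ∉ A := fun h => Finset.notMem_erase e m.E (hAE h)
      have hAm : insert e A ⊆ m.E :=
        Finset.insert_subset hem (hAE.trans (Finset.erase_subset _ _))
      rw [Finset.insert_eq e D, ← hA {e} (by simpa using hem), subsetSum_singleton,
        ← mul_assoc, subsetSum_delete_mul m heA hw, hA _ hAm, ← Finset.insert_eq,
        Finset.insert_union, Finset.union_insert]

lemma doubling_of_no_excluded_minor {f : BinaryFunction α}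
    (h₁ : ∀ m, IsMinorOf m f → ∀ e a, a ≠ 0 → a ≠ 1 → ¬ m.Isomorphic (fAlpha e a))
    (h₂ : ∀ m, IsMinorOf m f → ∀ a b, a ≠ b → ¬ m.Isomorphic (gTwo a b)) :
    f.SubsetSumDoubling ∧ f.NoParallelDoubling := by
  have hval : ∀ m, IsMinorOf m f → ∀ e ∈ m.E, m.f {e} = 0 ∨ m.f {e} = 1 := by
    intro m hm e he
    obtain ⟨m', hm', hE, hf⟩ := hm.exists_restrict (B := {e}) (by simpa using he)
    by_contra! hne
    rw [← hf] at hne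
    exact h₁ m' hm' e _ hne.1 hne.2 (isomorphic_fAlpha hE)
  have hdouble : f.SubsetSumDoubling := by
    intro D hD e he heD
    obtain ⟨m, hm, hmE, hA⟩ := exists_minor_deleting hval hD
    have hem : e ∈ m.E := by simp [hmE, he, heD]
    rw [Finset.insert_eq, ← hA {e} (by simpa using hem), subsetSum_singleton]
    rcases hval m hm e hem with h' | h' <;> rw [h'] <;> norm_num
  refine ⟨hdouble, ?_⟩
  rintro D hD a ha b hb haD hbD hab ⟨h_a, h_b, h_ab⟩
  obtain ⟨m, hm, hmE, hA⟩ := exists_minor_deleting hval hD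
  have hD0 := (hdouble.subsetSum_pos hD).ne'
  have ham : {a} ⊆ m.E := by simp [hmE, ha, haD]
  have hbm : {b} ⊆ m.E := by simp [hmE, hb, hbD]
  have habm : {a, b} ⊆ m.E := Finset.union_subset ham hbm
  have s_a : m.subsetSum {a} = 2 := mul_right_cancel₀ hD0 ((hA _ ham).trans h_a)
  have s_b : m.subsetSum {b} = 2 := mul_right_cancel₀ hD0 ((hA _ hbm).trans h_b)
  have s_ab : m.subsetSum {a, b} = 2 :=
    mul_right_cancel₀ hD0 ((hA _ habm).trans (by simpa [Finset.insert_union] using h_ab))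
  rw [subsetSum_singleton] at s_a s_b
  rw [subsetSum_pair m hab] at s_ab
  obtain ⟨m', hm', hE, hf⟩ := hm.exists_restrict habm
  exact h₂ m' hm' a b hab
    (isomorphic_gTwo hab hE (by rw [hf]; linarith) (by rw [hf]; linarith) (by rw [hf]; linarith))

lemma SubsetSumDoubling.not_isomorphic_fAlpha {m f : BinaryFunction α}
    (h : f.SubsetSumDoubling) (hm : IsMinorOf m f) {e : α} {a : ℝ} (h0 : a ≠ 0) (h1 : a ≠ 1) :
    ¬ m.Isomorphic (fAlpha e a) := by
  intro hiso
  obtain ⟨x, hE, rfl⟩ := hiso.exists_of_fAlpha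
  obtain ⟨hmE, D, hD, hdis, hD0, hA⟩ := hm.exists_deleted
  rw [hE] at hmE hdis hA
  have hsum := hA {x} subset_rfl
  rw [subsetSum_singleton, ← Finset.insert_eq] at hsum
  rcases h D hD x (by simpa using hmE) (by simpa using hdis) with h' | h'
  · exact h0 (mul_right_cancel₀ hD0 (by linarith))
  · exact h1 (mul_right_cancel₀ hD0 (by linarith))

lemma NoParallelDoubling.not_isomorphic_gTwo {m f : BinaryFunction α}
    (h : f.NoParallelDoubling) (hm : IsMinorOf m f) {a b : α} (hab : a ≠ b) :
    ¬ m.Isomorphic (gTwo a b) := by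
  intro hiso
  obtain ⟨x, y, hxy, hE, hx, hy, hxy'⟩ := hiso.exists_of_gTwo hab
  obtain ⟨hmE, D, hD, hdis, -, hA⟩ := hm.exists_deleted
  rw [hE] at hmE hdis hA
  have hsx := hA {x} (by simp)
  have hsy := hA {y} (by simp)
  have hsxy := hA {x, y} subset_rfl
  rw [subsetSum_singleton, ← Finset.insert_eq] at hsx hsy
  rw [subsetSum_pair m hxy, Finset.insert_union, ← Finset.insert_eq] at hsxy
  rw [Finset.disjoint_right] at hdis
  refine h D hD x (hmE (by simp)) y (hmE (by simp)) (hdis (by simp)) (hdis (by simp)) hxy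
    ⟨?_, ?_, ?_⟩
  · rw [← hsx, hx]; ring
  · rw [← hsy, hy]; ring
  · rw [← hsxy, hx, hy, hxy']; ring

end BinaryFunction

open BinaryFunction in
/-- A binary function is 1-polymatroidal (matroidal) iff it has no minor
isomorphic to `f_α` (`α ∉ {0,1}`) or to the order-two function `g`. -/
theorem matroidal_iff_no_excluded_minor {α : Type} [DecidableEq α] (f : BinaryFunction α) :
    f.Polymatroidal 1 ↔
      ¬ ∃ m : BinaryFunction α, IsMinorOf m f ∧
          ((∃ (e : α) (a : ℝ), a ≠ 0 ∧ a ≠ 1 ∧ m.Isomorphic (fAlpha e a)) ∨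
           (∃ a b : α, a ≠ b ∧ m.Isomorphic (gTwo a b))) := by
  rw [polymatroidal_one_iff_doubling]
  constructor
  · rintro ⟨h, h'⟩ ⟨m, hm, ⟨e, a, h0, h1, hiso⟩ | ⟨a, b, hab, hiso⟩⟩
    · exact h.not_isomorphic_fAlpha hm h0 h1 hiso
    · exact h'.not_isomorphic_gTwo hm hab hiso
  · intro h
    exact doubling_of_no_excluded_minor
      (fun m hm e a h0 h1 hiso => h ⟨m, hm, .inl ⟨e, a, h0, h1, hiso⟩⟩)
      (fun m hm a b hab hiso => h ⟨m, hm, .inr ⟨a, b, hab, hiso⟩⟩)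
end
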